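/- Let p ≥ n₁ ≥ 1 and let X₁ be a random p×n₁ real matrix whose entries are i.i.d. standard Gaussian N(0,1). Let P₁ = X₁(X₁ᵀX₁)⁻¹X₁ᵀ be the orthogonal projection onto the column space of X₁ (defined almost surely, since X₁ᵀX₁ is invertible almost surely). Then for every fixed vector w ∈ ℝᵖ, E[‖(I − P₁) w‖₂²] = (1 − n₁/p)·‖w‖₂². -/

import Mathlib

open Matrix MeasureTheory ProbabilityTheory

/-- The law of a `p × n` random matrix (viewed as `Fin p → Fin n → ℝ`) with i.i.d. standard
Gaussian `N(0,1)` entries. -/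
noncomputable def stdGaussianMatrix (p n : ℕ) : Measure (Fin p → Fin n → ℝ) :=
  Measure.pi fun _ => Measure.pi fun _ => gaussianReal 0 1

/-- A finite power of an absolutely continuous measure is absolutely continuous. -/
lemma pi_const_absolutelyContinuous {α : Type*} [MeasurableSpace α] {μ ν : Measure α}
    [SigmaFinite μ] [SigmaFinite ν] (h : μ ≪ ν) (n : ℕ) :
    Measure.pi (fun _ : Fin n => μ) ≪ Measure.pi (fun _ : Fin n => ν) := by
  induction n with
  | zero => rw [Measure.pi_of_empty, Measure.pi_of_empty]
  | succ n ih =>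
    have hμ := (measurePreserving_piFinSuccAbove (fun _ : Fin (n + 1) => μ) 0).symm
    have hν := (measurePreserving_piFinSuccAbove (fun _ : Fin (n + 1) => ν) 0).symm
    rw [← hμ.map_eq, ← hν.map_eq]
    exact (h.prod ih).map hν.measurable

lemma stdGaussianMatrix_absolutelyContinuous (p n : ℕ) :
    stdGaussianMatrix p n ≪ volume :=
  pi_const_absolutelyContinuous
    (pi_const_absolutelyContinuous (gaussianReal_absolutelyContinuous 0 one_ne_zero) n) p

instance (p n : ℕ) : IsProbabilityMeasure (stdGaussianMatrix p n) := by
  unfold stdGaussianMatrix; infer_instance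

/-- The matrix `I - X (XᵀX)⁻¹ Xᵀ`, which is the orthogonal projection onto the complement of the
column space of `X` when `XᵀX` is invertible. -/
noncomputable def projCompl {m n : Type*} [Fintype m] [DecidableEq m] [Fintype n] [DecidableEq n]
    (X : Matrix m n ℝ) : Matrix m m ℝ :=
  1 - X * (Xᵀ * X)⁻¹ * Xᵀ

section projCompl

variable {m n : Type*} [Fintype m] [DecidableEq m] [Fintype n] [DecidableEq n]

lemma projCompl_transpose (X : Matrix m n ℝ) : (projCompl X)ᵀ = projCompl X := by
  simp [projCompl, transpose_nonsing_inv, Matrix.mul_assoc]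

lemma projCompl_mul_self (X : Matrix m n ℝ) : projCompl X * projCompl X = projCompl X := by
  have hG : (Xᵀ * X)⁻¹ * (Xᵀ * X) * (Xᵀ * X)⁻¹ = (Xᵀ * X)⁻¹ := by
    by_cases h : IsUnit (Xᵀ * X).det
    · rw [nonsing_inv_mul _ h, Matrix.one_mul]
    · simp [nonsing_inv_apply_not_isUnit _ h]
  have hH : X * (Xᵀ * X)⁻¹ * Xᵀ * (X * (Xᵀ * X)⁻¹ * Xᵀ) = X * (Xᵀ * X)⁻¹ * Xᵀ := by
    calc _ = X * ((Xᵀ * X)⁻¹ * (Xᵀ * X) * (Xᵀ * X)⁻¹) * Xᵀ := by simp only [Matrix.mul_assoc]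
      _ = _ := by rw [hG]
  rw [projCompl, Matrix.sub_mul, Matrix.mul_sub, Matrix.mul_sub, hH]
  simp

lemma projCompl_apply_comm (X : Matrix m n ℝ) (i j : m) : projCompl X i j = projCompl X j i :=
  congrFun (congrFun (projCompl_transpose X) j) i

lemma sum_sq_projCompl (X : Matrix m n ℝ) (j : m) :
    ∑ i, projCompl X i j ^ 2 = projCompl X j j := by
  conv_rhs => rw [← projCompl_mul_self, Matrix.mul_apply]
  exact Finset.sum_congr rfl fun i _ => by rw [projCompl_apply_comm X j i, sq]

lemma abs_projCompl_le_one (X : Matrix m n ℝ) (i j : m) : |projCompl X i j| ≤ 1 := by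
  have key (k : m) : projCompl X k j ^ 2 ≤ projCompl X j j := by
    rw [← sum_sq_projCompl X j]
    exact Finset.single_le_sum (f := fun i => projCompl X i j ^ 2) (fun i _ => sq_nonneg _)
      (Finset.mem_univ k)
  have h1 : projCompl X j j ≤ 1 := by nlinarith [key j]
  exact (sq_le_one_iff_abs_le_one _).1 ((key i).trans h1)

lemma sum_sq_projCompl_mulVec (X : Matrix m n ℝ) (w : m → ℝ) :
    ∑ i, (projCompl X *ᵥ w) i ^ 2 = ∑ i, ∑ j, w i * w j * projCompl X i j := by
  calc ∑ i, (projCompl X *ᵥ w) i ^ 2 = (projCompl X *ᵥ w) ⬝ᵥ (projCompl X *ᵥ w) := by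
        simp [dotProduct, sq]
    _ = w ⬝ᵥ (projCompl X *ᵥ w) := by
        rw [dotProduct_mulVec, vecMul_mulVec, projCompl_transpose, projCompl_mul_self,
          ← dotProduct_mulVec]
    _ = _ := by
        simp only [dotProduct, mulVec, Finset.mul_sum]
        exact Finset.sum_congr rfl fun i _ => Finset.sum_congr rfl fun j _ => by ring

lemma trace_projCompl (X : Matrix m n ℝ) (h : IsUnit (Xᵀ * X).det) :
    (projCompl X).trace = Fintype.card m - Fintype.card n := by
  rw [projCompl, trace_sub, trace_one, trace_mul_comm, ← Matrix.mul_assoc,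
    mul_nonsing_inv _ h, trace_one]

lemma projCompl_submatrix_equiv (X : Matrix m n ℝ) (e : m ≃ m) :
    projCompl (X.submatrix e id) = (projCompl X).submatrix e e := by
  have h : (X.submatrix e id)ᵀ * X.submatrix e id = Xᵀ * X := by
    rw [transpose_submatrix, submatrix_mul_equiv, submatrix_id_id]
  ext i j
  rw [projCompl, h]
  simp [projCompl, Matrix.mul_apply, Matrix.one_apply]

lemma projCompl_diagonal_mul (X : Matrix m n ℝ) (d : m → ℝ) (hd : ∀ i, d i * d i = 1) :
    projCompl (diagonal d * X) = diagonal d * projCompl X * diagonal d := by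
  have hD : diagonal d * diagonal d = 1 := by simp [diagonal_mul_diagonal, hd]
  have h : (diagonal d * X)ᵀ * (diagonal d * X) = Xᵀ * X := by
    rw [transpose_mul, diagonal_transpose, Matrix.mul_assoc, ← Matrix.mul_assoc (diagonal d), hD,
      Matrix.one_mul]
  rw [projCompl, h, projCompl, Matrix.mul_sub, Matrix.sub_mul, Matrix.mul_one, hD, transpose_mul,
    diagonal_transpose]
  simp only [Matrix.mul_assoc]

lemma measurable_projCompl (i j : m) :
    Measurable fun ω : m → n → ℝ => projCompl (Matrix.of ω) i j := by
  have hX : Continuous fun ω : m → n → ℝ => (Matrix.of ω)ᵀ * Matrix.of ω := by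
    have : Continuous fun ω : m → n → ℝ => (Matrix.of ω : Matrix m n ℝ) := continuous_id
    fun_prop
  have hinv (k l : n) :
      Measurable fun ω : m → n → ℝ => ((Matrix.of ω)ᵀ * Matrix.of ω)⁻¹ k l := by
    simp only [inv_def, Ring.inverse_eq_inv', Matrix.smul_apply, smul_eq_mul]
    exact hX.matrix_det.measurable.inv.mul (hX.matrix_adjugate.matrix_elem k l).measurable
  simp only [projCompl, Matrix.sub_apply, Matrix.mul_apply (N := (Matrix.of _)ᵀ),
    Matrix.mul_apply (N := (_)⁻¹)]
  refine measurable_const.sub (Finset.measurable_fun_sum _ fun k _ => Measurable.mul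
    (Finset.measurable_fun_sum _ fun l _ => Measurable.mul ?_ (hinv l k)) ?_) <;>
  simp only [transpose_apply, of_apply] <;> fun_prop

end projCompl

lemma isUnit_det_transpose_mul_self {p n : ℕ} (hp : n ≤ p) (X : Matrix (Fin p) (Fin n) ℝ)
    (h : (X.submatrix (Fin.castLE hp) id).det ≠ 0) : IsUnit (Xᵀ * X).det := by
  rw [isUnit_iff_ne_zero]
  intro h0
  obtain ⟨v, hv, hv0⟩ := exists_mulVec_eq_zero_iff.2 h0
  refine hv (eq_zero_of_mulVec_eq_zero h ?_)
  have hX : X *ᵥ v = 0 := by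
    rw [← dotProduct_self_eq_zero, dotProduct_mulVec, vecMul_mulVec, ← dotProduct_mulVec, hv0,
      dotProduct_zero]
  ext i
  exact congrFun hX (Fin.castLE hp i)

lemma ae_det_submatrix_ne_zero {p n : ℕ} (hp : n ≤ p) :
    ∀ᵐ ω : Fin p → Fin n → ℝ, ((Matrix.of ω).submatrix (Fin.castLE hp) id).det ≠ 0 := by
  have hc : Continuous fun ω : Fin p → Fin n → ℝ =>
      ((Matrix.of ω).submatrix (Fin.castLE hp) id).det := by
    have : Continuous fun ω : Fin p → Fin n → ℝ => (Matrix.of ω : Matrix _ _ ℝ) := continuous_id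
    fun_prop
  let E : Fin p → Fin n → ℝ := fun i j => if i = Fin.castLE hp j then 1 else 0
  refine ae_mem_of_ae_add_linearMap_mem (LinearMap.toSpanSingleton ℝ _ E) volume volume
    (s := {ω | ((Matrix.of ω).submatrix (Fin.castLE hp) id).det ≠ 0})
    (hc.measurable (measurableSet_singleton 0).compl) fun ω => ?_
  let A := (Matrix.of ω).submatrix (Fin.castLE hp) id
  have hfin : {t : ℝ | (-A).charpoly.IsRoot t}.Finite :=
    Polynomial.finite_setOfPred_isRoot (-A).charpoly_monic.ne_zero
  filter_upwards [hfin.measure_zero volume |> measure_eq_zero_iff_ae_notMem.1] with t ht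
  have hE : (Matrix.of (ω + t • E)).submatrix (Fin.castLE hp) id = scalar (Fin n) t - -A := by
    ext i j
    simp [A, E, Matrix.diagonal_apply, add_comm]
  simpa [hE, Polynomial.IsRoot, eval_charpoly] using ht

lemma ae_isUnit_det_transpose_mul_self {p n : ℕ} (hp : n ≤ p) :
    ∀ᵐ ω ∂stdGaussianMatrix p n, IsUnit (det ((Matrix.of ω)ᵀ * Matrix.of ω)) :=
  (stdGaussianMatrix_absolutelyContinuous p n).ae_le <|
    (ae_det_submatrix_ne_zero hp).mono fun _ h => isUnit_det_transpose_mul_self hp _ h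

lemma integrable_projCompl (p n : ℕ) (i j : Fin p) :
    Integrable (fun ω => projCompl (Matrix.of ω) i j) (stdGaussianMatrix p n) :=
  .of_bound (measurable_projCompl i j).aestronglyMeasurable 1 <|
    .of_forall fun _ => abs_projCompl_le_one _ i j

/-- Changing the signs of the rows preserves the law of a standard Gaussian matrix. -/
lemma measurePreserving_diagonal_mul (p n : ℕ) (d : Fin p → ℝ) (hd : ∀ i, d i = 1 ∨ d i = -1) :
    MeasurePreserving (fun (ω : Fin p → Fin n → ℝ) i k => d i * ω i k)
      (stdGaussianMatrix p n) (stdGaussianMatrix p n) := by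
  refine measurePreserving_pi (f := fun i (x : Fin n → ℝ) k => d i * x k) _ _ fun i =>
    measurePreserving_pi (f := fun _ t => d i * t) _ _ fun _ => ?_
  refine ⟨by fun_prop, ?_⟩
  rcases hd i with h | h
  · simp [h]
  · simpa [h] using gaussianReal_map_neg (μ := 0) (v := 1)

/-- Permuting the rows preserves the law of a standard Gaussian matrix. -/
lemma measurePreserving_comp_equiv (p n : ℕ) (e : Fin p ≃ Fin p) :
    MeasurePreserving (fun (ω : Fin p → Fin n → ℝ) i => ω (e i))
      (stdGaussianMatrix p n) (stdGaussianMatrix p n) := by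
  have := measurePreserving_piCongrLeft
    (fun _ : Fin p => Measure.pi fun _ : Fin n => gaussianReal 0 1) e.symm
  have hf : (fun (ω : Fin p → Fin n → ℝ) i => ω (e i)) =
      MeasurableEquiv.piCongrLeft (fun _ : Fin p => Fin n → ℝ) e.symm := by
    ext ω i
    simp [MeasurableEquiv.coe_piCongrLeft, Equiv.piCongrLeft_apply]
  rw [hf]
  exact this

lemma integral_comp_measurePreserving {p n : ℕ} {f : (Fin p → Fin n → ℝ) → Fin p → Fin n → ℝ}
    (hf : MeasurePreserving f (stdGaussianMatrix p n) (stdGaussianMatrix p n)) (i j : Fin p) :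
    ∫ ω, projCompl (Matrix.of (f ω)) i j ∂stdGaussianMatrix p n =
      ∫ ω, projCompl (Matrix.of ω) i j ∂stdGaussianMatrix p n := by
  conv_rhs => rw [← hf.map_eq]
  exact (integral_map hf.aemeasurable
    (measurable_projCompl i j).aestronglyMeasurable).symm

lemma integral_projCompl_offDiag {p n : ℕ} {i j : Fin p} (hij : i ≠ j) :
    ∫ ω, projCompl (Matrix.of ω) i j ∂stdGaussianMatrix p n = 0 := by
  let d : Fin p → ℝ := fun k => if k = i then -1 else 1
  have hd (k : Fin p) : d k = 1 ∨ d k = -1 := by by_cases h : k = i <;> simp [d, h]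
  have h := integral_comp_measurePreserving (measurePreserving_diagonal_mul p n d hd) i j
  have hQ (ω : Fin p → Fin n → ℝ) :
      projCompl (Matrix.of fun i k => d i * ω i k) i j = -projCompl (Matrix.of ω) i j := by
    have hω : (Matrix.of fun i k => d i * ω i k) = diagonal d * Matrix.of ω := by
      ext; simp [diagonal_mul]
    rw [hω, projCompl_diagonal_mul _ _ fun k => by rcases hd k with h | h <;> simp [h]]
    simp [d, diagonal_mul, mul_diagonal, hij.symm]
  simp only [hQ, integral_neg] at h
  linarith

lemma integral_projCompl_diag_eq {p n : ℕ} (i j : Fin p) :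
    ∫ ω, projCompl (Matrix.of ω) i i ∂stdGaussianMatrix p n =
      ∫ ω, projCompl (Matrix.of ω) j j ∂stdGaussianMatrix p n := by
  have h := integral_comp_measurePreserving
    (measurePreserving_comp_equiv p n (Equiv.swap i j)) j j
  have hQ (ω : Fin p → Fin n → ℝ) :
      projCompl (Matrix.of fun k => ω (Equiv.swap i j k)) j j = projCompl (Matrix.of ω) i i := by
    refine (congrFun (congrFun
      (projCompl_submatrix_equiv (Matrix.of ω) (Equiv.swap i j)) j) j).trans ?_
    simp
  simpa only [hQ] using h

lemma integral_projCompl_diag {p n : ℕ} (hp : n ≤ p) (i : Fin p) :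
    ∫ ω, projCompl (Matrix.of ω) i i ∂stdGaussianMatrix p n = 1 - (n : ℝ) / p := by
  have htr : ∫ ω, (projCompl (Matrix.of ω)).trace ∂stdGaussianMatrix p n = (p : ℝ) - n := by
    rw [integral_congr_ae (g := fun _ => (p : ℝ) - n)
      ((ae_isUnit_det_transpose_mul_self hp).mono fun ω h => by simp [trace_projCompl _ h])]
    simp
  have hsum : (p : ℝ) * ∫ ω, projCompl (Matrix.of ω) i i ∂stdGaussianMatrix p n = p - n := by
    rw [← htr]
    simp only [trace, diag_apply]
    rw [integral_finsetSum _ fun k _ => integrable_projCompl p n k k,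
      Finset.sum_congr rfl fun k _ => integral_projCompl_diag_eq k i]
    simp
  have hp0 : (p : ℝ) ≠ 0 := by exact_mod_cast i.pos.ne'
  field_simp
  linarith

/-- **Expected squared norm of the complementary Gaussian projection.** If `X₁` is a random
`p × n₁` matrix with i.i.d. `N(0,1)` entries (`1 ≤ n₁ ≤ p`) and `P₁ = X₁(X₁ᵀX₁)⁻¹X₁ᵀ`, then
for every fixed `w ∈ ℝᵖ`, `E[‖(I − P₁) w‖₂²] = (1 − n₁/p)·‖w‖₂²`. -/
theorem expected_sq_norm_proj_compl {p n₁ : ℕ} (hn : 1 ≤ n₁) (hp : n₁ ≤ p) (w : Fin p → ℝ) :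
    (∫ ω : Fin p → Fin n₁ → ℝ,
        (∑ i, (((1 : Matrix (Fin p) (Fin p) ℝ) -
            Matrix.of ω * ((Matrix.of ω)ᵀ * Matrix.of ω)⁻¹ * (Matrix.of ω)ᵀ) *ᵥ w) i ^ 2)
        ∂(stdGaussianMatrix p n₁)) =
      (1 - (n₁ : ℝ) / (p : ℝ)) * ∑ i, w i ^ 2 := by
  change ∫ ω, ∑ i, (projCompl (Matrix.of ω) *ᵥ w) i ^ 2 ∂stdGaussianMatrix p n₁ = _
  simp only [sum_sq_projCompl_mulVec]
  rw [integral_finsetSum _ fun i _ => integrable_finsetSum _ fun j _ =>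
    (integrable_projCompl p n₁ i j).const_mul _, Finset.mul_sum]
  refine Finset.sum_congr rfl fun i _ => ?_
  rw [integral_finsetSum _ fun j _ => (integrable_projCompl p n₁ i j).const_mul _,
    Finset.sum_eq_single i _ (by simp), integral_const_mul, integral_projCompl_diag hp]
  · ring
  · intro j _ hj
    rw [integral_const_mul, integral_projCompl_offDiag hj.symm, mul_zero]
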